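/- If a space X has a full q-skeleton, then every compact subspace of C_p(X) is Corson compact. -/

import Mathlib

open Filter Topology Set

universe u v

/-- `[X]^{≤ω}`: the countable subsets of `X`, ordered by inclusion. -/
abbrev CtbSet (X : Type*) := {A : Set X // A.Countable}

/-- A map between families of countable sets is `ω`-monotone if it is monotone with respect to
inclusion and preserves unions of increasing `ω`-chains. -/
def OmegaMonotone {X Y : Type*} (φ : CtbSet X → CtbSet Y) : Prop :=
  (∀ A B : CtbSet X, A.1 ⊆ B.1 → (φ A).1 ⊆ (φ B).1) ∧
  ∀ (A : ℕ → CtbSet X) (B : CtbSet X), (∀ n, (A n).1 ⊆ (A (n + 1)).1) →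
    B.1 = ⋃ n, (A n).1 → (φ B).1 = ⋃ n, (φ (A n)).1

/-- An assignment of sets indexed by a poset `Γ` is `ω`-monotone if it is order preserving and
sends suprema of increasing `ω`-chains to the union of the images. -/
def OmegaMonotoneIdx {Γ Y : Type*} [Preorder Γ] (D : Γ → Set Y) : Prop :=
  (∀ s t : Γ, s ≤ t → D s ⊆ D t) ∧
  ∀ (s : ℕ → Γ) (t : Γ), Monotone s → IsLUB (Set.range s) t → D t = ⋃ n, D (s n)

/-- `N` is a network of the map `f`. -/
def IsNetworkOfMap {X Y : Type*} [TopologicalSpace Y] (N : Set (Set X)) (f : X → Y) : Prop :=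
  ∀ x : X, ∀ U : Set Y, IsOpen U → f x ∈ U → ∃ M ∈ N, x ∈ M ∧ f '' M ⊆ U

/-- `q : X → Y` is an `ℝ`-quotient map. -/
def RQuotient {X Y : Type*} [TopologicalSpace X] [TopologicalSpace Y] (q : X → Y) : Prop :=
  Continuous q ∧ Function.Surjective q ∧ ∀ g : Y → ℝ, Continuous (g ∘ q) → Continuous g

/-- The family `r` of retractions indexed by `Γ` is an `r`-skeleton on `X`. -/
structure IsRSkeleton {X : Type*} [TopologicalSpace X] {Γ : Type*} [PartialOrder Γ]
    (r : Γ → X → X) : Prop where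
  directed : ∀ s t : Γ, ∃ u, s ≤ u ∧ t ≤ u
  sigma : ∀ s : ℕ → Γ, Monotone s → ∃ t, IsLUB (Set.range s) t
  cont : ∀ s, Continuous (r s)
  retract : ∀ s x, r s (r s x) = r s x
  cosmic : ∀ s, ∃ N : Set (Set X), N.Countable ∧ (∀ M ∈ N, M ⊆ Set.range (r s)) ∧
    ∀ x ∈ Set.range (r s), ∀ U : Set X, IsOpen U → x ∈ U → ∃ M ∈ N, x ∈ M ∧ M ⊆ U
  comm₁ : ∀ s t : Γ, s ≤ t → ∀ x, r s (r t x) = r s x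
  comm₂ : ∀ s t : Γ, s ≤ t → ∀ x, r t (r s x) = r s x
  chain : ∀ (s : ℕ → Γ) (t : Γ), Monotone s → IsLUB (Set.range s) t →
    ∀ x, Tendsto (fun n => r (s n) x) atTop (𝓝 (r t x))
  toId : ∀ x : X, Tendsto (fun s : Γ => r s x) atTop (𝓝 x)

def IsFullRSkeleton {X : Type*} [TopologicalSpace X] {Γ : Type*} [PartialOrder Γ]
    (r : Γ → X → X) : Prop :=
  IsRSkeleton r ∧ ∀ x : X, ∃ s : Γ, x ∈ Set.range (r s)

def HasFullRSkeleton (X : Type u) [TopologicalSpace X] : Prop :=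
  ∃ (Γ : Type u) (inst : PartialOrder Γ) (r : Γ → X → X), @IsFullRSkeleton X _ Γ inst r

/-- A strong `r`-skeleton: an `r`-skeleton such that for every index `s`, every `n` and every
closed subset `F` of `X^n` there is `t ≥ s` whose `n`-th power maps `F` into itself. -/
def IsStrongRSkeleton {X : Type*} [TopologicalSpace X] {Γ : Type*} [PartialOrder Γ]
    (r : Γ → X → X) : Prop :=
  IsRSkeleton r ∧ ∀ (s : Γ) (n : ℕ) (F : Set (Fin n → X)), IsClosed F →
    ∃ t : Γ, s ≤ t ∧ (fun (v : Fin n → X) (i : Fin n) => r t (v i)) '' F ⊆ F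

def HasStrongRSkeleton (X : Type u) [TopologicalSpace X] : Prop :=
  ∃ (Γ : Type u) (inst : PartialOrder Γ) (r : Γ → X → X), @IsStrongRSkeleton X _ Γ inst r

/-- A `q`-skeleton on `X` indexed by the up-directed σ-complete poset `Γ`. -/
structure QSkeleton (X : Type u) [TopologicalSpace X] (Γ : Type v) [PartialOrder Γ] where
  Xs : Γ → Type u
  top : ∀ s, TopologicalSpace (Xs s)
  q : ∀ s, X → Xs s
  D : Γ → Set X
  directed : ∀ s t : Γ, ∃ u, s ≤ u ∧ t ≤ u
  sigma : ∀ s : ℕ → Γ, Monotone s → ∃ t, IsLUB (Set.range s) t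
  rquot : ∀ s, @RQuotient X (Xs s) _ (top s) (q s)
  D_ctble : ∀ s, (D s).Countable
  dense : ∀ s, @Dense (Xs s) (top s) (q s '' D s)
  proj : ∀ s t : Γ, s ≤ t → ∃ p : Xs t → Xs s, @Continuous _ _ (top t) (top s) p ∧
    Function.Surjective p ∧ ∀ x, q s x = p (q t x)
  Dmono : OmegaMonotoneIdx D

/-- The `q`-skeleton is full: `C_p(X) = ⋃_s q_s^*(C_p(X_s))`. -/
def QSkeleton.Full {X : Type u} [TopologicalSpace X] {Γ : Type v} [PartialOrder Γ]
    (S : QSkeleton X Γ) : Prop :=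
  ∀ f : X → ℝ, Continuous f →
    ∃ (s : Γ) (g : S.Xs s → ℝ), @Continuous _ _ (S.top s) _ g ∧ f = g ∘ S.q s

def HasFullQSkeleton (X : Type u) [TopologicalSpace X] : Prop :=
  ∃ (Γ : Type u) (inst : PartialOrder Γ) (S : @QSkeleton X _ Γ inst), S.Full

/-- `C_p(X)`: continuous real-valued functions with the topology of pointwise convergence. -/
abbrev Cp (X : Type u) [TopologicalSpace X] : Type u := {f : X → ℝ // Continuous f}

/-- The diagonal map `Δ_A : X → ℝ^A` of a set `A ⊆ C_p(X)`. -/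
def cpDiag {X : Type u} [TopologicalSpace X] (A : Set (Cp X)) (x : X) : ↥A → ℝ :=
  fun f => f.1.1 x

/-- The topology of the Alexandroff duplicate on `X × Bool`. -/
def ADTopology (X : Type*) [TopologicalSpace X] : TopologicalSpace (X × Bool) where
  IsOpen V := ∀ p ∈ V, p.2 = false →
    ∃ U : Set X, IsOpen U ∧ p.1 ∈ U ∧ {q : X × Bool | q.1 ∈ U ∧ q ≠ (p.1, true)} ⊆ V
  isOpen_univ := fun p _ _ => ⟨Set.univ, isOpen_univ, trivial, fun _ _ => trivial⟩
  isOpen_inter := fun A B hA hB p hp hb => by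
    obtain ⟨U, hU, hxU, hUA⟩ := hA p hp.1 hb
    obtain ⟨W, hW, hxW, hWB⟩ := hB p hp.2 hb
    exact ⟨U ∩ W, hU.inter hW, ⟨hxU, hxW⟩,
      fun q hq => ⟨hUA ⟨hq.1.1, hq.2⟩, hWB ⟨hq.1.2, hq.2⟩⟩⟩
  isOpen_sUnion := fun S hS p hp hb => by
    obtain ⟨V, hV, hpV⟩ := hp
    obtain ⟨U, hU, hxU, hUV⟩ := hS V hV p hpV hb
    exact ⟨U, hU, hxU, fun q hq => ⟨V, hV, hUV hq⟩⟩

/-- The Alexandroff duplicate of `X`. -/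
def AD (X : Type u) [TopologicalSpace X] : Type u := X × Bool

instance (X : Type u) [TopologicalSpace X] : TopologicalSpace (AD X) := ADTopology X

/-- A compact Hausdorff space is Corson compact if it embeds into a Σ-product of real lines. -/
def IsCorsonCompact (X : Type u) [TopologicalSpace X] : Prop :=
  CompactSpace X ∧ T2Space X ∧ ∃ (κ : Type u) (e : X → κ → ℝ),
    IsEmbedding e ∧ ∀ x, {i | e x i ≠ 0}.Countable

/-- The assignments `r`, `N` witness that `X` is monotonically retractable. -/
structure MonRetractableWitness (X : Type u) [TopologicalSpace X]
    (r : CtbSet X → X → X) (N : CtbSet X → CtbSet (Set X)) : Prop where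
  cont : ∀ A, Continuous (r A)
  retract : ∀ A x, r A (r A x) = r A x
  sub : ∀ A : CtbSet X, A.1 ⊆ Set.range (r A)
  network : ∀ A, IsNetworkOfMap (N A).1 (r A)
  mono : OmegaMonotone N

def MonotonicallyRetractable (X : Type u) [TopologicalSpace X] : Prop :=
  ∃ (r : CtbSet X → X → X) (N : CtbSet X → CtbSet (Set X)), MonRetractableWitness X r N

/-- `X` is monotonically `ω`-stable. -/
def MonotonicallyOmegaStable (X : Type u) [TopologicalSpace X] : Prop :=
  ∃ N : CtbSet (Cp X) → CtbSet (Set X), OmegaMonotone N ∧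
    ∀ A : CtbSet (Cp X), IsNetworkOfMap (N A).1 (cpDiag (closure A.1))

/-- A subset `K` is countably compact: every countable open cover of `K` has a finite subcover. -/
def IsCountablyCompactSet {X : Type*} [TopologicalSpace X] (K : Set X) : Prop :=
  ∀ U : ℕ → Set X, (∀ n, IsOpen (U n)) → K ⊆ ⋃ n, U n → ∃ t : Finset ℕ, K ⊆ ⋃ n ∈ t, U n

/-- The closure of `A` under `φ`. -/
def phiBar {X : Type*} (φ : CtbSet X → CtbSet X) (A : CtbSet X) : Set X :=
  ⋂₀ {B : Set X | ∃ hB : B.Countable, A.1 ⊆ B ∧ (φ ⟨B, hB⟩).1 ⊆ B}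

/-- The iterates `φ_n` of `φ`: `φ_0(A) = A`, `φ_{n+1}(A) = φ_n(A) ∪ φ(φ_n(A))`. -/
def phiIter {X : Type*} (φ : CtbSet X → CtbSet X) : ℕ → CtbSet X → CtbSet X
  | 0, A => A
  | n + 1, A => ⟨(phiIter φ n A).1 ∪ (φ (phiIter φ n A)).1,
      (phiIter φ n A).2.union (φ (phiIter φ n A)).2⟩

namespace QCorson

/-- Building a chain of indices while handling all the countable sets met on the way. -/
theorem chain_lemma {α : Type*} {G : Type*} {X : Type*} [Preorder G] (D : G → Set X)
    (hD : ∀ s, (D s).Countable) (P : Finset X → ℕ → G → α → Prop)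
    (h : ∀ s T n, ∃ s', s ≤ s' ∧ ∃ a, P T n s' a) (s0 : G) :
    ∃ (s : ℕ → G) (T : ℕ → Finset X) (a : ℕ → α), s 0 = s0 ∧ Monotone s ∧
      (∀ n, P (T n) n (s (n + 1)) (a n)) ∧ ∀ i, ∀ d ∈ D (s i), ∀ᶠ n in atTop, d ∈ T n := by
  classical
  have he : ∀ s, ∃ e : ℕ → Finset X, Monotone e ∧ ∀ d ∈ D s, ∃ m, d ∈ e m := by
    intro s
    by_cases hX : Nonempty X
    · obtain ⟨f, hf⟩ := Set.countable_iff_exists_subset_range.1 (hD s)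
      refine ⟨fun m => (Finset.range (m + 1)).image f, ?_, ?_⟩
      · intro m n hmn
        exact Finset.image_subset_image (Finset.range_mono (by omega))
      · intro d hd
        obtain ⟨m, rfl⟩ := hf hd
        exact ⟨m, Finset.mem_image_of_mem _ (by simp)⟩
    · exact ⟨fun _ => ∅, monotone_const, fun d _ => (hX ⟨d⟩).elim⟩
  choose e emono ecov using he
  choose nxt hn a ha using h
  let step : ℕ → G × (ℕ → Finset X) → G × (ℕ → Finset X) := fun n p =>
    (nxt p.1 (p.2 n) n, fun m => p.2 m ∪ e (nxt p.1 (p.2 n) n) m)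
  let st : ℕ → G × (ℕ → Finset X) := fun n =>
    Nat.rec (motive := fun _ => G × (ℕ → Finset X)) (s0, e s0) (fun n p => step n p) n
  have hst : ∀ n, st (n + 1) = step n (st n) := fun n => rfl
  have h1 : ∀ n, Monotone (st n).2 := by
    intro n
    induction n with
    | zero => exact emono s0
    | succ n ih =>
      rw [hst]
      intro m k hmk
      exact Finset.union_subset_union (ih hmk) (emono _ hmk)
  have h2 : ∀ n, e (st n).1 ≤ (st n).2 := by
    intro n
    cases n with
    | zero => exact le_rfl
    | succ n => rw [hst]; intro m; exact Finset.subset_union_right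
  have h3 : Monotone fun n => (st n).2 := by
    refine monotone_nat_of_le_succ fun n => ?_
    rw [hst]; intro m; exact Finset.subset_union_left
  refine ⟨fun n => (st n).1, fun n => (st n).2 n, fun n => a (st n).1 ((st n).2 n) n, rfl,
    monotone_nat_of_le_succ fun n => hn _ _ _, fun n => ha _ _ _, ?_⟩
  intro i d hd
  obtain ⟨m, hm⟩ := ecov _ d hd
  filter_upwards [eventually_ge_atTop (max i m)] with n hn
  exact h1 n (le_trans (le_max_right _ _) hn)
    (h3 (le_trans (le_max_left _ _) hn) m (h2 i m hm))

/-- Approximating on finite sets implies agreeing, by compactness. -/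
theorem approx {X K : Type*} [TopologicalSpace K] [CompactSpace K] (ev : K → X → ℝ)
    (hev : ∀ x, Continuous fun f => ev f x) (C : Set K) (hC : IsClosed C) (E : Set X) (f : K)
    (h : ∀ T : Finset X, (T : Set X) ⊆ E → ∀ ε > 0, ∃ g ∈ C, ∀ d ∈ T, |ev g d - ev f d| ≤ ε) :
    ∃ g ∈ C, ∀ d ∈ E, ev g d = ev f d := by
  classical
  have := hC.isCompact.inter_iInter_nonempty
    (fun i : E × {ε : ℝ // 0 < ε} => {g | |ev g i.1 - ev f i.1| ≤ i.2}) ?_ ?_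
  · obtain ⟨g, hg, hg'⟩ := this
    refine ⟨g, hg, fun d hd => ?_⟩
    rw [Set.mem_iInter] at hg'
    have : |ev g d - ev f d| ≤ 0 :=
      le_of_forall_pos_le_add fun ε hε => by simpa using hg' (⟨d, hd⟩, ⟨ε, hε⟩)
    exact sub_eq_zero.1 (abs_nonpos_iff.1 this)
  · intro i
    exact isClosed_le ((hev _).sub continuous_const).abs continuous_const
  · intro u
    have : ∃ ε > 0, ∀ i ∈ u, ε ≤ i.2.1 := by
      induction u using Finset.induction_on with
      | empty => exact ⟨1, one_pos, by simp⟩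
      | insert i u _ ih =>
        obtain ⟨ε, hε, h⟩ := ih
        refine ⟨min ε i.2.1, lt_min hε i.2.2, ?_⟩
        intro j hj
        rcases Finset.mem_insert.1 hj with rfl | hj
        · exact min_le_right _ _
        · exact (min_le_left _ _).trans (h j hj)
    obtain ⟨ε, hε, hu⟩ := this
    obtain ⟨g, hg, hgT⟩ := h (u.image fun i => i.1.1) (by
      intro x hx
      simp only [Finset.coe_image, Set.mem_image] at hx
      obtain ⟨i, _, rfl⟩ := hx
      exact i.1.2) ε hε
    refine ⟨g, hg, ?_⟩
    simp only [Set.mem_iInter]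
    intro i hi
    exact (hgT _ (Finset.mem_image_of_mem _ hi)).trans (hu i hi)

/-- The abstract system extracted from a full `q`-skeleton. -/
structure Sys (X K G : Type*) [TopologicalSpace K] [Preorder G] where
  ev : K → X → ℝ
  D : G → Set X
  F : G → Set K
  hev : ∀ x, Continuous fun f => ev f x
  inj : Function.Injective ev
  Dmono : ∀ s t, s ≤ t → D s ⊆ D t
  Dctb : ∀ s, (D s).Countable
  Fmono : ∀ s t, s ≤ t → F s ⊆ F t
  Fclosed : ∀ s, IsClosed (F s)
  Fdet : ∀ s, ∀ f ∈ F s, ∀ g ∈ F s, (∀ d ∈ D s, ev f d = ev g d) → f = g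
  dir : ∀ s t : G, ∃ u, s ≤ u ∧ t ≤ u
  chain : ∀ s : ℕ → G, Monotone s → ∃ t, (∀ n, s n ≤ t) ∧ D t = ⋃ n, D (s n)
  full : ∀ f, ∃ s, f ∈ F s

variable {X K G : Type*} [TopologicalSpace K] [Preorder G]

def Sys.Good (S : Sys X K G) (s : G) : Prop :=
  ∀ f, ∃ g ∈ S.F s, ∀ d ∈ S.D s, S.ev g d = S.ev f d

theorem finset_sub_iUnion (D : ℕ → Set X) (hD : Monotone D) (T : Finset X)
    (hT : (T : Set X) ⊆ ⋃ n, D n) : ∃ n, (T : Set X) ⊆ D n := by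
  classical
  induction T using Finset.induction_on with
  | empty => exact ⟨0, by simp⟩
  | insert x T _ ih =>
    rw [Finset.coe_insert, Set.insert_subset_iff] at hT
    obtain ⟨n, hn⟩ := ih hT.2
    obtain ⟨m, hm⟩ := Set.mem_iUnion.1 hT.1
    refine ⟨max n m, ?_⟩
    rw [Finset.coe_insert, Set.insert_subset_iff]
    exact ⟨hD (le_max_right _ _) hm, hn.trans (hD (le_max_left _ _))⟩

theorem Sys.good_chain [CompactSpace K] (S : Sys X K G) (s : ℕ → G) (hs : Monotone s)
    (hg : ∀ n, S.Good (s n)) (t : G) (ht : ∀ n, s n ≤ t) (hD : S.D t = ⋃ n, S.D (s n)) :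
    S.Good t := by
  intro f
  refine approx S.ev S.hev (S.F t) (S.Fclosed t) (S.D t) f ?_
  intro T hT ε hε
  rw [hD] at hT
  obtain ⟨n, hn⟩ := finset_sub_iUnion (fun n => S.D (s n)) (fun i j h => S.Dmono _ _ (hs h)) T hT
  obtain ⟨g, hg, hgd⟩ := hg n f
  exact ⟨g, S.Fmono _ _ (ht n) hg, fun d hd => by rw [hgd d (hn hd)]; simpa using hε.le⟩

theorem Sys.ub_finset (S : Sys X K G) (s : G) (B : Finset K) :
    ∃ s', s ≤ s' ∧ ∀ f ∈ B, f ∈ S.F s' := by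
  classical
  induction B using Finset.induction_on with
  | empty => exact ⟨s, le_rfl, by simp⟩
  | insert f B _ ih =>
    obtain ⟨s', h1, h2⟩ := ih
    obtain ⟨r, hr⟩ := S.full f
    obtain ⟨u, hu1, hu2⟩ := S.dir s' r
    refine ⟨u, h1.trans hu1, ?_⟩
    intro g hg
    rcases Finset.mem_insert.1 hg with rfl | hg
    · exact S.Fmono _ _ hu2 hr
    · exact S.Fmono _ _ hu1 (h2 g hg)

theorem exists_lt_eventually (ε : ℝ) (hε : 0 < ε) :
    ∀ᶠ n : ℕ in atTop, 1 / ((n : ℝ) + 1) < ε :=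
  (tendsto_order.1 tendsto_one_div_add_atTop_nhds_zero_nat).2 ε hε

theorem Sys.good_cofinal [CompactSpace K] (S : Sys X K G) (s0 : G) : ∃ t, s0 ≤ t ∧ S.Good t := by
  classical
  have hchain := chain_lemma (α := Finset K) S.D S.Dctb
    (fun T n s' B => (∀ f ∈ B, f ∈ S.F s') ∧
      ∀ f, ∃ b ∈ B, ∀ d ∈ T, |S.ev b d - S.ev f d| < 1 / ((n : ℝ) + 1)) ?_ s0
  · obtain ⟨s, T, B, hs0, hmono, hP, hcov⟩ := hchain
    obtain ⟨t, ht, hD⟩ := S.chain s hmono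
    refine ⟨t, hs0 ▸ ht 0, fun f => approx S.ev S.hev (S.F t) (S.Fclosed t) (S.D t) f ?_⟩
    intro E hE ε hε
    have h1 : ∀ᶠ n in atTop, ∀ d ∈ E, d ∈ T n := by
      rw [Filter.eventually_all_finset]
      intro d hd
      have := hE hd
      rw [hD] at this
      obtain ⟨i, hi⟩ := Set.mem_iUnion.1 this
      exact hcov i d hi
    obtain ⟨n, hn1, hn2⟩ := (h1.and (exists_lt_eventually ε hε)).exists
    obtain ⟨b, hb, hbd⟩ := (hP n).2 f
    exact ⟨b, S.Fmono _ _ (ht _) ((hP n).1 b hb), fun d hd =>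
      ((hbd d (hn1 d hd)).trans hn2).le⟩
  · intro s T n
    have hpos : (0 : ℝ) < 1 / ((n : ℝ) + 1) := by positivity
    obtain ⟨B, hB⟩ := CompactSpace.elim_nhds_subcover
      (fun b : K => {f | ∀ d ∈ T, |S.ev b d - S.ev f d| < 1 / ((n : ℝ) + 1)}) (by
        intro b
        change ∀ᶠ f in 𝓝 b, ∀ d ∈ T, |S.ev b d - S.ev f d| < 1 / ((n : ℝ) + 1)
        rw [Filter.eventually_all_finset]
        intro d _
        refine (isOpen_lt (continuous_const.sub (S.hev d)).abs continuous_const).mem_nhds ?_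
        simpa using hpos)
    obtain ⟨s', h1, h2⟩ := S.ub_finset s B
    refine ⟨s', h1, B, h2, fun f => ?_⟩
    have : f ∈ (⊤ : Set K) := trivial
    rw [← hB] at this
    simpa using this

/-- The subsystem of good indices. -/
def Sys.restrict [CompactSpace K] (S : Sys X K G) : Sys X K {s // S.Good s} where
  ev := S.ev
  D s := S.D s.1
  F s := S.F s.1
  hev := S.hev
  inj := S.inj
  Dmono s t h := S.Dmono _ _ h
  Dctb s := S.Dctb _
  Fmono s t h := S.Fmono _ _ h
  Fclosed s := S.Fclosed _
  Fdet s := S.Fdet _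
  dir s t := by
    obtain ⟨u, h1, h2⟩ := S.dir s.1 t.1
    obtain ⟨v, h3, h4⟩ := S.good_cofinal u
    exact ⟨⟨v, h4⟩, h1.trans h3, h2.trans h3⟩
  chain s hs := by
    obtain ⟨t, h1, h2⟩ := S.chain (fun n => (s n).1) hs
    exact ⟨⟨t, S.good_chain _ hs (fun n => (s n).2) t h1 h2⟩, h1, h2⟩
  full f := by
    obtain ⟨s, hs⟩ := S.full f
    obtain ⟨v, h3, h4⟩ := S.good_cofinal s
    exact ⟨⟨v, h4⟩, S.Fmono _ _ h3 hs⟩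

/-- Union of the countable sets over a set of indices. -/
def Sys.DA (S : Sys X K G) (A : Set G) : Set X := ⋃ s ∈ A, S.D s

/-- Closure of the union of the closed sets over a set of indices. -/
def Sys.KA (S : Sys X K G) (A : Set G) : Set K := closure (⋃ s ∈ A, S.F s)

theorem Sys.DA_mono (S : Sys X K G) {A B : Set G} (h : A ⊆ B) : S.DA A ⊆ S.DA B :=
  Set.biUnion_subset_biUnion_left h

theorem Sys.KA_mono (S : Sys X K G) {A B : Set G} (h : A ⊆ B) : S.KA A ⊆ S.KA B :=
  closure_mono (Set.biUnion_subset_biUnion_left h)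

theorem Sys.mem_KA_approx (S : Sys X K G) {A : Set G} {f : K} (hf : f ∈ S.KA A) (T : Finset X)
    (ε : ℝ) (hε : 0 < ε) : ∃ s ∈ A, ∃ u ∈ S.F s, ∀ d ∈ T, |S.ev u d - S.ev f d| < ε := by
  have hev : ∀ᶠ u in 𝓝 f, ∀ d ∈ T, |S.ev u d - S.ev f d| < ε := by
    rw [Filter.eventually_all_finset]
    intro d _
    refine (isOpen_lt ((S.hev d).sub continuous_const).abs continuous_const).mem_nhds ?_
    simpa using hε
  obtain ⟨u, hu, hu'⟩ := mem_closure_iff_nhds.1 hf _ hev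
  obtain ⟨s, hs, hus⟩ := Set.mem_iUnion₂.1 hu'
  exact ⟨s, hs, u, hus, hu⟩

theorem Sys.KA_det [CompactSpace K] (S : Sys X K G) (A : Set G) (hA : DirectedOn (· ≤ ·) A)
    (f g : K) (hf : f ∈ S.KA A) (hg : g ∈ S.KA A) (h : ∀ d ∈ S.DA A, S.ev f d = S.ev g d) :
    f = g := by
  classical
  apply S.inj
  funext x
  obtain ⟨s0, hs0, -⟩ := S.mem_KA_approx hf ∅ 1 one_pos
  have hchain := chain_lemma (α := K × K) (G := A) (fun s => S.D s.1)
    (fun s => S.Dctb s.1)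
    (fun T n s' p => p.1 ∈ S.F s'.1 ∧ p.2 ∈ S.F s'.1 ∧
      (∀ d ∈ insert x T, |S.ev p.1 d - S.ev f d| < 1 / ((n : ℝ) + 1)) ∧
      (∀ d ∈ insert x T, |S.ev p.2 d - S.ev g d| < 1 / ((n : ℝ) + 1))) ?_ ⟨s0, hs0⟩
  · obtain ⟨s, T, a, -, hmono, hP, hcov⟩ := hchain
    obtain ⟨t, ht, hD⟩ := S.chain (fun n => (s n).1) hmono
    have key : ∀ (E : Finset X), (E : Set X) ⊆ insert x (S.D t) → ∀ ε > 0, ∃ n,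
        (∀ d ∈ E, d ∈ insert x (T n)) ∧ 1 / ((n : ℝ) + 1) < ε := by
      intro E hE ε hε
      have h1 : ∀ᶠ n in atTop, ∀ d ∈ E, d ∈ insert x (T n) := by
        rw [Filter.eventually_all_finset]
        intro d hd
        rcases hE hd with rfl | this
        · exact Eventually.of_forall fun n => Finset.mem_insert_self _ _
        · rw [hD] at this
          obtain ⟨i, hi⟩ := Set.mem_iUnion.1 this
          filter_upwards [hcov i d hi] with n hn using Finset.mem_insert_of_mem hn
      exact (h1.and (exists_lt_eventually ε hε)).exists
    obtain ⟨u, hu, hud⟩ := approx S.ev S.hev (S.F t) (S.Fclosed t) (insert x (S.D t)) f (by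
      intro E hE ε hε
      obtain ⟨n, h1, h2⟩ := key E hE ε hε
      exact ⟨(a n).1, S.Fmono _ _ (ht _) (hP n).1, fun d hd =>
        (((hP n).2.2.1 d (h1 d hd)).trans h2).le⟩)
    obtain ⟨v, hv, hvd⟩ := approx S.ev S.hev (S.F t) (S.Fclosed t) (insert x (S.D t)) g (by
      intro E hE ε hε
      obtain ⟨n, h1, h2⟩ := key E hE ε hε
      exact ⟨(a n).2, S.Fmono _ _ (ht _) (hP n).2.1, fun d hd =>
        (((hP n).2.2.2 d (h1 d hd)).trans h2).le⟩)
    have huv : u = v := S.Fdet t u hu v hv (by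
      intro d hd
      rw [hud d (Or.inr hd), hvd d (Or.inr hd)]
      apply h
      rw [hD] at hd
      obtain ⟨i, hi⟩ := Set.mem_iUnion.1 hd
      exact Set.mem_iUnion₂.2 ⟨(s i).1, (s i).2, hi⟩)
    rw [← hud x (Or.inl rfl), ← hvd x (Or.inl rfl), huv]
  · intro s T n
    have hpos : (0 : ℝ) < 1 / ((n : ℝ) + 1) := by positivity
    obtain ⟨s1, hs1, u, hu, hud⟩ := S.mem_KA_approx hf (insert x T) _ hpos
    obtain ⟨s2, hs2, v, hv, hvd⟩ := S.mem_KA_approx hg (insert x T) _ hpos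
    obtain ⟨s3, hs3, h31, h32⟩ := hA _ hs1 _ hs2
    obtain ⟨s4, hs4, h43, h4s⟩ := hA _ hs3 _ s.2
    exact ⟨⟨s4, hs4⟩, h4s, (u, v), S.Fmono _ _ (h31.trans h43) hu,
      S.Fmono _ _ (h32.trans h43) hv, hud, hvd⟩

theorem Sys.KA_tight [CompactSpace K] (S : Sys X K G) (A : Set G) (hA : DirectedOn (· ≤ ·) A)
    (f : K) (hf : f ∈ S.KA A) :
    ∃ c : ℕ → G, (∀ n, c n ∈ A) ∧ f ∈ S.KA (Set.range c) := by
  classical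
  obtain ⟨s0, hs0, -⟩ := S.mem_KA_approx hf ∅ 1 one_pos
  obtain ⟨t0, ht0⟩ := S.full f
  have hchain := chain_lemma (α := K) (G := A × G) (fun s => S.D s.2)
    (fun s => S.Dctb s.2)
    (fun T n s' u => u ∈ S.F s'.1.1 ∧ u ∈ S.F s'.2 ∧
      (∀ d ∈ T, |S.ev u d - S.ev f d| < 1 / ((n : ℝ) + 1))) ?_ (⟨s0, hs0⟩, t0)
  · obtain ⟨s, T, a, h0, hmono, hP, hcov⟩ := hchain
    obtain ⟨t, ht, hD⟩ := S.chain (fun n => (s n).2) (fun i j h => (hmono h).2)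
    refine ⟨fun n => (s n).1.1, fun n => (s n).1.2, ?_⟩
    have hft : f ∈ S.F t := S.Fmono _ _ (ht 0) (by rw [h0]; exact ht0)
    obtain ⟨u, hu, hud⟩ := approx S.ev S.hev (S.KA (Set.range fun n => (s n).1.1) ∩ S.F t)
      (isClosed_closure.inter (S.Fclosed t)) (S.D t) f (by
      intro E hE ε hε
      have h1 : ∀ᶠ n in atTop, ∀ d ∈ E, d ∈ T n := by
        rw [Filter.eventually_all_finset]
        intro d hd
        have := hE hd
        rw [hD] at this
        obtain ⟨i, hi⟩ := Set.mem_iUnion.1 this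
        exact hcov i d hi
      obtain ⟨n, hn1, hn2⟩ := (h1.and (exists_lt_eventually ε hε)).exists
      refine ⟨a n, ⟨subset_closure (Set.mem_iUnion₂.2 ⟨_, ⟨n + 1, rfl⟩, (hP n).1⟩),
        S.Fmono _ _ (ht _) (hP n).2.1⟩, fun d hd => (((hP n).2.2 d (hn1 d hd)).trans hn2).le⟩)
    rw [← S.Fdet t u hu.2 f hft hud]
    exact hu.1
  · intro s T n
    have hpos : (0 : ℝ) < 1 / ((n : ℝ) + 1) := by positivity
    obtain ⟨s1, hs1, u, hu, hud⟩ := S.mem_KA_approx hf T _ hpos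
    obtain ⟨s3, hs3, h31, h32⟩ := hA _ hs1 _ s.1.2
    obtain ⟨t', h1, h2⟩ := S.dir s.2 s3
    exact ⟨(⟨s3, hs3⟩, t'), ⟨h32, h1⟩, u, S.Fmono _ _ h31 hu,
      S.Fmono _ _ (h31.trans h2) hu, hud⟩

theorem Sys.exists_retr [CompactSpace K] (S : Sys X K G) (hgood : ∀ s, S.Good s) (A : Set G)
    (hA : DirectedOn (· ≤ ·) A) (hne : A.Nonempty) :
    ∃ r : K → K, Continuous r ∧ ∀ f, r f ∈ S.KA A ∧ ∀ d ∈ S.DA A, S.ev (r f) d = S.ev f d := by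
  classical
  have hex : ∀ f, ∃ g ∈ S.KA A, ∀ d ∈ S.DA A, S.ev g d = S.ev f d := by
    intro f
    refine approx S.ev S.hev (S.KA A) isClosed_closure (S.DA A) f ?_
    intro T hT ε hε
    have : ∃ s ∈ A, (T : Set X) ⊆ S.D s := by
      clear hε
      induction T using Finset.induction_on with
      | empty => exact hne.imp fun s hs => ⟨hs, by simp⟩
      | insert x T _ ih =>
        rw [Finset.coe_insert, Set.insert_subset_iff] at hT
        obtain ⟨s, hs, h1⟩ := ih hT.2
        obtain ⟨t, htA, h2⟩ := Set.mem_iUnion₂.1 hT.1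
        obtain ⟨u, hu, hsu, htu⟩ := hA s hs t htA
        refine ⟨u, hu, ?_⟩
        rw [Finset.coe_insert, Set.insert_subset_iff]
        exact ⟨S.Dmono _ _ htu h2, h1.trans (S.Dmono _ _ hsu)⟩
    obtain ⟨s, hs, hTs⟩ := this
    obtain ⟨g, hg, hgd⟩ := hgood s f
    exact ⟨g, subset_closure (Set.mem_iUnion₂.2 ⟨s, hs, hg⟩), fun d hd => by
      rw [hgd d (hTs hd)]; simpa using hε.le⟩
  choose r hr hrd using hex
  refine ⟨r, ?_, fun f => ⟨hr f, hrd f⟩⟩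
  rw [continuous_iff_isClosed]
  intro C hC
  have : r ⁻¹' C = Prod.fst '' {p : K × K | p.2 ∈ C ∧ p.2 ∈ S.KA A ∧
      ∀ d ∈ S.DA A, S.ev p.2 d = S.ev p.1 d} := by
    ext f
    constructor
    · intro hf
      exact ⟨(f, r f), ⟨hf, hr f, hrd f⟩, rfl⟩
    · rintro ⟨⟨f', g⟩, ⟨h1, h2, h3⟩, rfl⟩
      have : r f' = g := S.KA_det A hA _ _ (hr f') h2 fun d hd => by
        rw [hrd f' d hd]; exact (h3 d hd).symm
      change r f' ∈ C
      rw [this]; exact h1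
  rw [this]
  apply isClosedMap_fst_of_compactSpace
  refine (hC.preimage continuous_snd).inter
    ((isClosed_closure.preimage continuous_snd).inter ?_)
  have hcl : IsClosed {p : K × K | ∀ d ∈ S.DA A, S.ev p.2 d = S.ev p.1 d} := by
    simp only [Set.ofPred_forall]
    exact isClosed_biInter fun d _ =>
      isClosed_eq ((S.hev d).comp continuous_snd) ((S.hev d).comp continuous_fst)
  exact hcl

/-- Directed closure of a set of indices. -/
inductive Cl (m : G → G → G) (s0 : G) (B : Set G) : G → Prop
  | base : Cl m s0 B s0
  | of (s : G) (hs : s ∈ B) : Cl m s0 B s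
  | op (s t : G) (hs : Cl m s0 B s) (ht : Cl m s0 B t) : Cl m s0 B (m s t)

def cl (m : G → G → G) (s0 : G) (B : Set G) : Set G := {s | Cl m s0 B s}

theorem cl_mono (m : G → G → G) (s0 : G) {B B' : Set G} (h : B ⊆ B') :
    cl m s0 B ⊆ cl m s0 B' := by
  intro s hs
  induction hs with
  | base => exact Cl.base
  | of s hs => exact Cl.of s (h hs)
  | op s t _ _ h1 h2 => exact Cl.op s t h1 h2

theorem cl_directed (m : G → G → G) (hm : ∀ s t, s ≤ m s t ∧ t ≤ m s t) (s0 : G) (B : Set G) :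
    DirectedOn (· ≤ ·) (cl m s0 B) :=
  fun s hs t ht => ⟨m s t, Cl.op s t hs ht, (hm s t).1, (hm s t).2⟩

theorem cl_countable (m : G → G → G) (s0 : G) {B : Set G} (hB : B.Countable) :
    (cl m s0 B).Countable := by
  let I : ℕ → Set G := fun n => Nat.rec (motive := fun _ => Set G) (insert s0 B)
    (fun _ C => C ∪ Set.image2 m C C) n
  have hI : ∀ n, I (n + 1) = I n ∪ Set.image2 m (I n) (I n) := fun n => rfl
  have hmono : Monotone I := monotone_nat_of_le_succ fun n => by
    rw [hI]; exact Set.subset_union_left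
  have hc : ∀ n, (I n).Countable := by
    intro n
    induction n with
    | zero => exact hB.insert s0
    | succ n ih => rw [hI]; exact ih.union (ih.image2 ih m)
  refine (Set.countable_iUnion hc).mono ?_
  intro s hs
  rw [Set.mem_iUnion]
  induction hs with
  | base => exact ⟨0, Or.inl rfl⟩
  | of s hs => exact ⟨0, Or.inr hs⟩
  | op s t _ _ h1 h2 =>
    obtain ⟨i, hi⟩ := h1
    obtain ⟨j, hj⟩ := h2
    refine ⟨max i j + 1, ?_⟩
    rw [hI]
    exact Or.inr ⟨s, hmono (le_max_left _ _) hi, t, hmono (le_max_right _ _) hj, rfl⟩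

theorem cl_lin (m : G → G → G) (s0 : G) {ι : Type*} [LinearOrder ι] (b : ι → G) (L : Set ι)
    (s : G) (hs : s ∈ cl m s0 (b '' L)) :
    s ∈ cl m s0 ∅ ∨ ∃ β ∈ L, s ∈ cl m s0 (b '' Set.Iic β) := by
  induction hs with
  | base => exact Or.inl Cl.base
  | of s hs =>
    obtain ⟨β, hβ, rfl⟩ := hs
    exact Or.inr ⟨β, hβ, Cl.of _ ⟨β, Set.mem_Iic.2 le_rfl, rfl⟩⟩
  | op s t _ _ h1 h2 =>
    have hup : ∀ {β γ : ι}, β ≤ γ → cl m s0 (b '' Set.Iic β) ⊆ cl m s0 (b '' Set.Iic γ) :=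
      fun h => cl_mono m s0 (Set.image_mono (Set.Iic_subset_Iic.2 h))
    have hem : ∀ {γ : ι}, cl m s0 ∅ ⊆ cl m s0 (b '' Set.Iic γ) :=
      fun {γ} => cl_mono m s0 (Set.empty_subset _)
    rcases h1 with h1 | ⟨β, hβ, h1⟩ <;> rcases h2 with h2 | ⟨γ, hγ, h2⟩
    · exact Or.inl (Cl.op _ _ h1 h2)
    · exact Or.inr ⟨γ, hγ, Cl.op _ _ (hem h1) h2⟩
    · exact Or.inr ⟨β, hβ, Cl.op _ _ h1 (hem h2)⟩
    · rcases le_total β γ with h | h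
      · exact Or.inr ⟨γ, hγ, Cl.op _ _ (hup h h1) h2⟩
      · exact Or.inr ⟨β, hβ, Cl.op _ _ h1 (hup h h2)⟩

/-- The inductive claim: coordinates for the points of `K` modulo agreeing on `DA A`. -/
def Sys.Coord {X K G : Type u} [TopologicalSpace K] [Preorder G] (S : Sys X K G)
    (A : Set G) : Prop :=
  ∃ (I : Type u) (φ : K → I → ℝ), Continuous φ ∧ (∀ f, {i | φ f i ≠ 0}.Countable) ∧
    ∀ f g, φ f = φ g ↔ ∀ d ∈ S.DA A, S.ev f d = S.ev g d

theorem Sys.coord_countable {X K G : Type u} [TopologicalSpace K] [Preorder G] (S : Sys X K G)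
    (A : Set G) (hA : A.Countable) : S.Coord A := by
  have hc : (S.DA A).Countable := hA.biUnion fun s _ => S.Dctb s
  have : Countable (S.DA A) := hc.to_subtype
  refine ⟨S.DA A, fun f d => S.ev f d.1, continuous_pi fun d => S.hev _,
    fun f => Set.to_countable _, fun f g => ?_⟩
  rw [funext_iff]
  exact ⟨fun h d hd => h ⟨d, hd⟩, fun h d => h d.1 d.2⟩

theorem Sys.coord_step {X K G : Type u} [TopologicalSpace K] [Preorder G] [CompactSpace K]
    (S : Sys X K G) (hgood : ∀ s, S.Good s) (m : G → G → G)
    (hm : ∀ s t, s ≤ m s t ∧ t ≤ m s t) (s0 : G) {ι : Type u} [LinearOrder ι] [WellFoundedLT ι]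
    (b : ι → G) (ih : ∀ α, S.Coord (cl m s0 (b '' Set.Iic α))) :
    S.Coord (cl m s0 (Set.range b)) := by
  classical
  obtain ⟨I0, φ0, hφ0c, hφ0s, hφ0⟩ := S.coord_countable (cl m s0 ∅)
    (cl_countable m s0 Set.countable_empty)
  choose I φ hφc hφs hφ using ih
  have hr : ∀ L : Set ι, ∃ r : K → K, Continuous r ∧ ∀ f, r f ∈ S.KA (cl m s0 (b '' L)) ∧
      ∀ d ∈ S.DA (cl m s0 (b '' L)), S.ev (r f) d = S.ev f d :=
    fun L => S.exists_retr hgood _ (cl_directed m hm s0 _) ⟨s0, Cl.base⟩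
  choose r hrc hrK using hr
  have hcl : ∀ {L L' : Set ι}, L ⊆ L' → cl m s0 (b '' L) ⊆ cl m s0 (b '' L') :=
    fun h => cl_mono m s0 (Set.image_mono h)
  have hem : ∀ {L : Set ι}, cl m s0 ∅ ⊆ cl m s0 (b '' L) :=
    fun {L} => cl_mono m s0 (Set.empty_subset _)
  -- the set of essential indices is countable
  have hcount : ∀ f, {α : ι | ¬ ∀ d ∈ S.DA (cl m s0 (b '' Set.Iic α)),
      S.ev f d = S.ev (r (Set.Iio α) f) d}.Countable := by
    intro f
    set E := {α : ι | ¬ ∀ d ∈ S.DA (cl m s0 (b '' Set.Iic α)),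
      S.ev f d = S.ev (r (Set.Iio α) f) d} with hE
    have step : ∀ L : Set ι, IsLowerSet L → (∀ γ ∈ L, (E ∩ Set.Iic γ).Countable) →
        (E ∩ L).Countable := by
      intro L hL hγ
      rcases L.eq_empty_or_nonempty with rfl | ⟨l0, hl0⟩
      · simp
      obtain ⟨c, hcL, hc⟩ := S.KA_tight _ (cl_directed m hm s0 _) _ (hrK L f).1
      have hβ : ∀ n, ∃ β ∈ L, c n ∈ cl m s0 (b '' Set.Iic β) := by
        intro n
        rcases cl_lin m s0 b L (c n) (hcL n) with h | h
        · exact ⟨l0, hl0, hem h⟩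
        · exact h
      choose β hβL hβ using hβ
      by_cases hcase : ∃ γ ∈ L, ∀ n, c n ∈ cl m s0 (b '' Set.Iic γ)
      · obtain ⟨γ, hγL, hcγ⟩ := hcase
        refine (hγ γ hγL).mono ?_
        rintro α ⟨hαE, hαL⟩
        refine ⟨hαE, ?_⟩
        by_contra hlt
        rw [Set.mem_Iic, not_le] at hlt
        apply hαE
        have h1 : r L f ∈ S.KA (cl m s0 (b '' Set.Iio α)) := by
          refine S.KA_mono ?_ hc
          rintro _ ⟨n, rfl⟩
          exact hcl (fun x hx => lt_of_le_of_lt hx hlt) (hcγ n)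
        have hsub : Set.Iic α ⊆ L := fun x hx => hL hx hαL
        have h2 : r (Set.Iio α) f = r L f := by
          refine S.KA_det _ (cl_directed m hm s0 _) _ _ (hrK _ f).1 h1 fun d hd => ?_
          rw [(hrK _ f).2 d hd,
            (hrK L f).2 d (S.DA_mono (hcl (Set.Iio_subset_Iic_self.trans hsub)) hd)]
        intro d hd
        rw [h2, (hrK L f).2 d (S.DA_mono (hcl hsub) hd)]
      · push Not at hcase
        refine (Set.countable_iUnion fun n => hγ (β n) (hβL n)).mono ?_
        rintro α ⟨hαE, hαL⟩
        obtain ⟨n, hn⟩ := hcase α hαL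
        refine Set.mem_iUnion.2 ⟨n, hαE, ?_⟩
        by_contra hlt
        rw [Set.mem_Iic, not_le] at hlt
        exact hn (hcl (Set.Iic_subset_Iic.2 hlt.le) (hβ n))
    have hall : ∀ γ, (E ∩ Set.Iic γ).Countable := by
      intro γ
      induction γ using WellFoundedLT.induction with
      | ind γ ih =>
        have := step (Set.Iio γ) (isLowerSet_Iio γ) (fun δ hδ => ih δ hδ)
        refine (this.union (Set.countable_singleton γ)).mono ?_
        rintro α ⟨h1, h2⟩
        rcases lt_or_eq_of_le (Set.mem_Iic.1 h2) with h | h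
        · exact Or.inl ⟨h1, h⟩
        · exact Or.inr h
    simpa using step Set.univ isLowerSet_univ fun γ _ => hall γ
  refine ⟨I0 ⊕ (Σ α, I α), fun f => Sum.elim (φ0 f)
    (fun p => φ p.1 f p.2 - φ p.1 (r (Set.Iio p.1) f) p.2), ?_, ?_, ?_⟩
  · refine continuous_pi ?_
    rintro (i | ⟨α, i⟩)
    · exact (continuous_apply i).comp hφ0c
    · exact ((continuous_apply i).comp (hφc α)).sub
        ((continuous_apply i).comp ((hφc α).comp (hrc _)))
  · intro f
    have h1 := (hφ0s f).image (Sum.inl : I0 → I0 ⊕ (Σ α, I α))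
    have h2 : ∀ α, ({i | φ α f i ≠ 0} ∪ {i | φ α (r (Set.Iio α) f) i ≠ 0}).Countable :=
      fun α => (hφs α f).union (hφs α _)
    have h3 := (hcount f).biUnion fun α _ =>
      (h2 α).image (fun i => (Sum.inr ⟨α, i⟩ : I0 ⊕ (Σ α, I α)))
    refine (h1.union h3).mono ?_
    rintro (i | ⟨α, i⟩) hi
    · exact Or.inl ⟨i, hi, rfl⟩
    · refine Or.inr (Set.mem_iUnion₂.2 ⟨α, ?_, i, ?_, rfl⟩)
      · intro hall
        apply hi
        have := (hφ α f (r (Set.Iio α) f)).2 hall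
        simp [← this]
      · by_contra hn
        simp only [Set.mem_union, Set.mem_ofPred_eq, not_or, not_not] at hn
        exact hi (by simp [hn.1, hn.2])
  · intro f g
    constructor
    · intro hfg
      have e0 : ∀ d ∈ S.DA (cl m s0 ∅), S.ev f d = S.ev g d :=
        (hφ0 f g).1 (funext fun i => congrFun hfg (Sum.inl i))
      have glue : ∀ L : Set ι,
          (∀ β ∈ L, ∀ d ∈ S.DA (cl m s0 (b '' Set.Iic β)), S.ev f d = S.ev g d) →
          ∀ d ∈ S.DA (cl m s0 (b '' L)), S.ev f d = S.ev g d := by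
        intro L hL d hd
        obtain ⟨s, hs, hds⟩ := Set.mem_iUnion₂.1 hd
        rcases cl_lin m s0 b L s hs with h | ⟨β, hβ, h⟩
        · exact e0 d (Set.mem_iUnion₂.2 ⟨s, h, hds⟩)
        · exact hL β hβ d (Set.mem_iUnion₂.2 ⟨s, h, hds⟩)
      have hall : ∀ α, ∀ d ∈ S.DA (cl m s0 (b '' Set.Iic α)), S.ev f d = S.ev g d := by
        intro α
        induction α using WellFoundedLT.induction with
        | ind α ih =>
          have h1 := glue (Set.Iio α) (fun β hβ => ih β hβ)
          have h2 : r (Set.Iio α) f = r (Set.Iio α) g := by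
            refine S.KA_det _ (cl_directed m hm s0 _) _ _ (hrK _ f).1 (hrK _ g).1 fun d hd => ?_
            rw [(hrK _ f).2 d hd, (hrK _ g).2 d hd, h1 d hd]
          refine (hφ α f g).1 (funext fun i => ?_)
          have := congrFun hfg (Sum.inr ⟨α, i⟩)
          simp only [Sum.elim_inr, h2] at this
          linarith
      rw [← Set.image_univ]
      exact glue Set.univ fun β _ => hall β
    · intro h
      have h' : ∀ L, ∀ d ∈ S.DA (cl m s0 (b '' L)), S.ev f d = S.ev g d := fun L d hd =>
        h d (S.DA_mono (cl_mono m s0 (Set.image_subset_range b L)) hd)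
      funext i
      rcases i with i | ⟨α, i⟩
      · exact congrFun ((hφ0 f g).2 fun d hd =>
          h d (S.DA_mono (cl_mono m s0 (Set.empty_subset _)) hd)) i
      · have h2 : r (Set.Iio α) f = r (Set.Iio α) g := by
          refine S.KA_det _ (cl_directed m hm s0 _) _ _ (hrK _ f).1 (hrK _ g).1 fun d hd => ?_
          rw [(hrK _ f).2 d hd, (hrK _ g).2 d hd, h' _ d hd]
        simp only [Sum.elim_inr, h2, (hφ α f g).2 (h' _)]

theorem Sys.coord_all {X K G : Type u} [TopologicalSpace K] [Preorder G] [CompactSpace K]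
    (S : Sys X K G) (hgood : ∀ s, S.Good s) (m : G → G → G)
    (hm : ∀ s t, s ≤ m s t ∧ t ≤ m s t) (s0 : G) (κ : Cardinal.{u}) :
    ∀ (ι : Type u) (b : ι → G), Cardinal.mk ι = κ → S.Coord (cl m s0 (Set.range b)) := by
  induction κ using WellFoundedLT.induction with
  | ind κ ih =>
    intro ι b hι
    by_cases hc : Countable ι
    · exact S.coord_countable _ (cl_countable m s0 (Set.countable_range b))
    · obtain ⟨_, _, hord⟩ := Cardinal.exists_ord_eq_type_lt ι
      refine S.coord_step hgood m hm s0 b fun α => ?_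
      have hlt : Cardinal.mk (Set.Iic α) < κ := by
        rw [← hι]
        refine Cardinal.mk_Iic_lt α hord ?_
        rw [← Cardinal.mk_le_aleph0_iff, not_le] at hc
        exact hc.le
      have := ih _ hlt (Set.Iic α) (fun i => b i.1) rfl
      rwa [show Set.range (fun i : Set.Iic α => b i.1) = b '' Set.Iic α from
        (Set.image_eq_range b (Set.Iic α)).symm] at this

theorem Sys.corson {X K G : Type u} [TopologicalSpace K] [Preorder G] [CompactSpace K]
    [T2Space K] (S : Sys X K G) [Nonempty G] : IsCorsonCompact K := by
  let R := S.restrict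
  have hgood : ∀ s, R.Good s := fun s => s.2
  obtain ⟨s0⟩ : Nonempty {s // S.Good s} := by
    obtain ⟨t, -, ht⟩ := S.good_cofinal (Classical.arbitrary G)
    exact ⟨⟨t, ht⟩⟩
  choose m hm using R.dir
  obtain ⟨I, φ, h1, h2, h3⟩ := R.coord_all hgood m hm s0 _ _ (fun i => i) rfl
  refine ⟨inferInstance, inferInstance, I, φ, (h1.isClosedEmbedding ?_).isEmbedding, h2⟩
  intro f g hfg
  have h4 := (h3 f g).1 hfg
  obtain ⟨s, hs⟩ := R.full f
  obtain ⟨t, ht⟩ := R.full g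
  obtain ⟨v, hsv, htv⟩ := R.dir s t
  refine R.Fdet v f (R.Fmono _ _ hsv hs) g (R.Fmono _ _ htv ht) fun d hd => h4 d ?_
  exact Set.mem_iUnion₂.2 ⟨v, Cl.of v ⟨v, rfl⟩, hd⟩

/-- The system of a full `q`-skeleton. -/
def toSys {X : Type u} [TopologicalSpace X] {Γ : Type u} [PartialOrder Γ] (Q : QSkeleton X Γ)
    (hQ : Q.Full) (K : Set (Cp X)) : Sys X K Γ where
  ev f := f.1.1
  D := Q.D
  F s := {f | ∀ x y, Q.q s x = Q.q s y → f.1.1 x = f.1.1 y}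
  hev x := (continuous_apply x).comp (continuous_subtype_val.comp continuous_subtype_val)
  inj f g h := Subtype.ext (Subtype.ext h)
  Dmono := Q.Dmono.1
  Dctb := Q.D_ctble
  Fmono s t h f hf x y hxy := by
    obtain ⟨p, -, -, hp⟩ := Q.proj s t h
    exact hf x y (by rw [hp x, hp y, hxy])
  Fclosed s := by
    have hev : ∀ x : X, Continuous fun f : K => f.1.1 x := fun x =>
      (continuous_apply x).comp (continuous_subtype_val.comp continuous_subtype_val)
    simp only [Set.ofPred_forall]
    exact isClosed_iInter fun x => isClosed_iInter fun y => isClosed_iInter fun _ =>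
      isClosed_eq (hev x) (hev y)
  Fdet s f hf g hg h := by
    letI := Q.top s
    obtain ⟨-, hsurj, hcont⟩ := Q.rquot s
    have lift : ∀ f : K, (∀ x y, Q.q s x = Q.q s y → f.1.1 x = f.1.1 y) →
        ∃ φ : Q.Xs s → ℝ, Continuous φ ∧ φ ∘ Q.q s = f.1.1 := by
      intro f hf
      have : (fun y => f.1.1 (Function.surjInv hsurj y)) ∘ Q.q s = f.1.1 :=
        funext fun x => hf _ _ (Function.surjInv_eq hsurj _)
      exact ⟨_, hcont _ (by rw [this]; exact f.1.2), this⟩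
    obtain ⟨φ, hφ, hφq⟩ := lift f hf
    obtain ⟨ψ, hψ, hψq⟩ := lift g hg
    have : φ = ψ := by
      refine hφ.ext_on (Q.dense s) hψ ?_
      rintro _ ⟨d, hd, rfl⟩
      have h1 := congrFun hφq d
      have h2 := congrFun hψq d
      simp only [Function.comp_apply] at h1 h2
      rw [h1, h2]
      exact h d hd
    apply Subtype.ext
    apply Subtype.ext
    rw [← hφq, ← hψq, this]
  dir := Q.directed
  chain s hs := by
    obtain ⟨t, ht⟩ := Q.sigma s hs
    exact ⟨t, fun n => ht.1 ⟨n, rfl⟩, Q.Dmono.2 s t hs ht⟩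
  full f := by
    obtain ⟨s, g, -, hg⟩ := hQ f.1.1 f.1.2
    exact ⟨s, fun x y hxy => by rw [hg]; simp [hxy]⟩

end QCorson

theorem isCorsonCompact_of_hasFullQSkeleton {X : Type u} [TopologicalSpace X] [T35Space X]
    (h : HasFullQSkeleton X) (K : Set (Cp X)) (hK : IsCompact K) :
    IsCorsonCompact ↥K := by
  obtain ⟨Γ, inst, Q, hQ⟩ := h
  haveI : CompactSpace K := isCompact_iff_compactSpace.1 hK
  haveI : Nonempty Γ := by
    obtain ⟨s, -⟩ := hQ (fun _ => 0) continuous_const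
    exact ⟨s⟩
  exact (QCorson.toSys Q hQ K).corson
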